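/- Let q be an odd prime power. (i) For every j ∈ {1,…,q}\{(q+1)/2} and every line ℓ of PG(3,q²), |ℓ ∩ S_j| ≤ 2q + 2. (ii) For every k ∈ {1,…,q−2}\{(q−1)/2} and every line ℓ of PG(3,q²) that is not entirely contained in E_k, |ℓ ∩ E_k| ≤ 2q + 2. -/

import Mathlib

noncomputable section

open Matrix

/-- The points of `PG(3,q²)`: the projectivization of `F⁴` where `F = 𝔽_{q²}`. -/
abbrev PGPoint (F : Type*) [Field F] := Projectivization F (Fin 4 → F)

/-- The form `F_γ(X₁,X₂,X₃,X₄) = X₁^q X₄ + X₁ X₄^q − X₂^{q+1} − X₃^{q+1}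
    − γ (X₁X₄ − X₂X₃)^{(q+1)/2}`. -/
def Fgam {F : Type*} [Field F] (q : ℕ) (γ : F) (x : Fin 4 → F) : F :=
  x 0 ^ q * x 3 + x 0 * x 3 ^ q - x 1 ^ (q + 1) - x 2 ^ (q + 1)
    - γ * (x 0 * x 3 - x 1 * x 2) ^ ((q + 1) / 2)

/-- The point set `C_γ` of `PG(3,q²)`, the zero locus of `F_γ`. -/
def Cgam {F : Type*} [Field F] (q : ℕ) (γ : F) : Set (PGPoint F) :=
  {P | ∀ (v : Fin 4 → F) (hv : v ≠ 0), P = Projectivization.mk F v hv → Fgam q γ v = 0}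

/-- Kronecker product of two 2×2 matrices, as a 4×4 matrix. -/
def kron {F : Type*} [Field F] (A B : Matrix (Fin 2) (Fin 2) F) :
    Matrix (Fin 4) (Fin 4) F :=
  Matrix.of fun i j =>
    A ⟨i.val / 2, by have := i.isLt; omega⟩ ⟨j.val / 2, by have := j.isLt; omega⟩ *
    B ⟨i.val % 2, by have := i.isLt; omega⟩ ⟨j.val % 2, by have := j.isLt; omega⟩

/-- Entrywise `q`-th power (the matrix `A^q`). -/
def matq {F : Type*} [Field F] (q : ℕ) (A : Matrix (Fin 2) (Fin 2) F) :
    Matrix (Fin 2) (Fin 2) F :=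
  A.map (· ^ q)

/-- The orbit of a point of `PG(3,q²)` under the group `K ≅ PSL(2,q²)` of projectivities
    induced by the matrices `A^q ⊗ A` with `A ∈ SL(2,𝔽_{q²})`. -/
def Korb {F : Type*} [Field F] (q : ℕ) (P : PGPoint F) : Set (PGPoint F) :=
  {P' | ∃ A : Matrix (Fin 2) (Fin 2) F, A.det = 1 ∧
    ∃ (v : Fin 4 → F) (hv : v ≠ 0) (hw : Matrix.vecMul v (kron (matq q A) A) ≠ 0),
      P = Projectivization.mk F v hv ∧ P' = Projectivization.mk F _ hw}

/-- The orbit of a point of `PG(3,q²)` under the group `G ≅ PGL(2,q²)` of projectivities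
    induced by the matrices `A^q ⊗ A` with `A ∈ GL(2,𝔽_{q²})`. -/
def Gorb {F : Type*} [Field F] (q : ℕ) (P : PGPoint F) : Set (PGPoint F) :=
  {P' | ∃ A : Matrix (Fin 2) (Fin 2) F, A.det ≠ 0 ∧
    ∃ (v : Fin 4 → F) (hv : v ≠ 0) (hw : Matrix.vecMul v (kron (matq q A) A) ≠ 0),
      P = Projectivization.mk F v hv ∧ P' = Projectivization.mk F _ hw}

/-- The Hermitian Veronese curve `O = {(1,t,t^q,t^{q+1})} ∪ {(0,0,0,1)}`. -/
def Oset (F : Type*) [Field F] (q : ℕ) : Set (PGPoint F) :=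
  {P | (∃ (t : F) (hv : ![1, t, t ^ q, t ^ (q + 1)] ≠ 0),
        P = Projectivization.mk F _ hv) ∨
    ∃ (hv : (![0, 0, 0, 1] : Fin 4 → F) ≠ 0), P = Projectivization.mk F _ hv}

/-- The Baer subgeometry `Σ = {(a,b,b^q,c) : a,c ∈ 𝔽_q, b ∈ 𝔽_{q²}}`. -/
def SigmaSet (F : Type*) [Field F] (q : ℕ) : Set (PGPoint F) :=
  {P | ∃ (a b c : F) (hv : ![a, b, b ^ q, c] ≠ 0),
    a ^ q = a ∧ c ^ q = c ∧ P = Projectivization.mk F _ hv}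

/-- The hyperbolic quadric `Q⁺(3,q²) : X₁X₄ − X₂X₃ = 0`. -/
def Qplus (F : Type*) [Field F] : Set (PGPoint F) :=
  {P | ∀ (v : Fin 4 → F) (hv : v ≠ 0), P = Projectivization.mk F v hv →
    v 0 * v 3 - v 1 * v 2 = 0}

/-- A line of `PG(3,q²)`: the set of points lying in a 2-dimensional subspace. -/
def IsLine {F : Type*} [Field F] (ℓ : Set (PGPoint F)) : Prop :=
  ∃ W : Submodule F (Fin 4 → F), Module.finrank F W = 2 ∧ ℓ = {P | P.rep ∈ W}

/-- A plane of `PG(3,q²)`: the set of points lying in a 3-dimensional subspace. -/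
def IsPlane {F : Type*} [Field F] (π : Set (PGPoint F)) : Prop :=
  ∃ W : Submodule F (Fin 4 → F), Module.finrank F W = 3 ∧ π = {P | P.rep ∈ W}

theorem Fgam_smul {F : Type*} [Field F] {q : ℕ} (hq : Odd q) (γ c : F) (v : Fin 4 → F) :
    Fgam q γ (c • v) = c ^ (q + 1) * Fgam q γ v := by
  obtain ⟨m, rfl⟩ := hq
  have hm : (2 * m + 1 + 1) / 2 = m + 1 := by omega
  have hQ : c * v 0 * (c * v 3) - c * v 1 * (c * v 2) = c ^ 2 * (v 0 * v 3 - v 1 * v 2) := by ring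
  simp only [Fgam, Pi.smul_apply, smul_eq_mul, hm, hQ]
  simp only [mul_pow]
  ring

theorem mem_Cgam_mk {F : Type*} [Field F] {q : ℕ} (hq : Odd q) (γ : F) (v : Fin 4 → F)
    (hv : v ≠ 0) : Projectivization.mk F v hv ∈ Cgam q γ ↔ Fgam q γ v = 0 := by
  refine ⟨fun h => h v hv rfl, fun h w hw hvw => ?_⟩
  obtain ⟨c, hc⟩ := (Projectivization.mk_eq_mk_iff' F w v hw hv).1 hvw.symm
  rw [← hc, Fgam_smul hq, h, mul_zero]

/-- The restriction of `F_γ` to an affine line is a polynomial of degree at most `q + 1`. -/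
theorem exists_polynomial_Fgam {F : Type*} [Field F] {q : ℕ} (hq : Odd q) (γ : F)
    (a b : Fin 4 → F) :
    ∃ f : Polynomial F, f.natDegree ≤ q + 1 ∧ ∀ t, f.eval t = Fgam q γ (b + t • a) := by
  obtain ⟨m, rfl⟩ := hq
  have hm : (2 * m + 1 + 1) / 2 = m + 1 := by omega
  let L : Fin 4 → Polynomial F := fun i => Polynomial.C (b i) + Polynomial.X * Polynomial.C (a i)
  have hL : ∀ i, (L i).natDegree ≤ 1 := fun i => by
    simp only [L]; compute_degree
  have hpow : ∀ i k, (L i ^ k).natDegree ≤ k := fun i k =>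
    (Polynomial.natDegree_pow_le_of_le k (hL i)).trans_eq (mul_one k)
  refine ⟨L 0 ^ (2 * m + 1) * L 3 + L 0 * L 3 ^ (2 * m + 1) - L 1 ^ (2 * m + 1 + 1)
    - L 2 ^ (2 * m + 1 + 1) - Polynomial.C γ * (L 0 * L 3 - L 1 * L 2) ^ (m + 1), ?_, ?_⟩
  · have h1 := Polynomial.natDegree_mul_le_of_le (hpow 0 (2 * m + 1)) (hL 3)
    have h2 := Polynomial.natDegree_mul_le_of_le (hL 0) (hpow 3 (2 * m + 1))
    rw [add_comm 1] at h2
    have hQ : (L 0 * L 3 - L 1 * L 2).natDegree ≤ 2 :=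
      Polynomial.natDegree_sub_le_of_le (Polynomial.natDegree_mul_le_of_le (hL 0) (hL 3))
        (Polynomial.natDegree_mul_le_of_le (hL 1) (hL 2))
    have h5 := (Polynomial.natDegree_C_mul_le γ _).trans
      (Polynomial.natDegree_pow_le_of_le (m + 1) hQ)
    have h5' := h5.trans (by omega : (m + 1) * 2 ≤ 2 * m + 1 + 1)
    exact Polynomial.natDegree_sub_le_iff_left h5' |>.2 <|
      Polynomial.natDegree_sub_le_iff_left (hpow 2 _) |>.2 <|
      Polynomial.natDegree_sub_le_iff_left (hpow 1 _) |>.2 <|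
      Polynomial.natDegree_add_le_of_degree_le h1 h2
  · intro t
    simp [Fgam, L, hm, mul_comm t]

/-- A line not contained in `C_γ` meets it in at most `q + 2` points. -/
theorem ncard_line_inter_Cgam_le {F : Type*} [Field F] {q : ℕ} (hq : Odd q) (γ : F)
    {ℓ : Set (PGPoint F)} (hℓ : IsLine ℓ) (hsub : ¬ ℓ ⊆ Cgam q γ) :
    (ℓ ∩ Cgam q γ).ncard ≤ q + 2 := by
  classical
  obtain ⟨W, hW, rfl⟩ := hℓ
  obtain ⟨P, hPW, hPC⟩ := Set.not_subset.1 hsub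
  rw [← P.mk_rep, mem_Cgam_mk hq] at hPC
  change P.rep ∈ W at hPW
  set b := P.rep with hb
  have hb0 : b ≠ 0 := P.rep_nonzero
  obtain ⟨a, haW, hab⟩ : ∃ a ∈ W, a ∉ Submodule.span F {b} := by
    by_contra! h
    have := Submodule.finrank_mono (show W ≤ Submodule.span F {b} from h)
    rw [hW, finrank_span_singleton hb0] at this
    omega
  have hne : ∀ t : F, b + t • a ≠ 0 := by
    intro t ht
    rcases eq_or_ne t 0 with rfl | h0
    · simp [hb0] at ht
    · apply hab
      rw [Submodule.mem_span_singleton]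
      refine ⟨-t⁻¹, ?_⟩
      rw [eq_neg_of_add_eq_zero_left ht, smul_neg, neg_smul, neg_neg, smul_smul,
        inv_mul_cancel₀ h0, one_smul]
  have ha0 : a ≠ 0 := fun h => hab (h ▸ Submodule.zero_mem _)
  have hspan : ∀ w ∈ W, ∃ r s : F, w = r • b + s • a := by
    have hli : LinearIndependent F ![b, a] := by
      rw [LinearIndependent.pair_iff' hb0]
      exact fun c hc => hab (Submodule.mem_span_singleton.2 ⟨c, hc⟩)
    have hle : Submodule.span F {b, a} ≤ W := by
      rw [Submodule.span_le]
      rintro x (rfl | rfl)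
      exacts [hPW, haW]
    have hfr : Module.finrank F (Submodule.span F {b, a}) = 2 := by
      have := finrank_span_eq_card hli
      rwa [Matrix.range_cons_cons_empty, Fintype.card_fin] at this
    intro w hw
    rw [← Submodule.eq_of_le_of_finrank_eq hle (hfr.trans hW.symm)] at hw
    obtain ⟨r, s, h⟩ := Submodule.mem_span_pair.1 hw
    exact ⟨r, s, h.symm⟩
  obtain ⟨f, hdeg, hf⟩ := exists_polynomial_Fgam hq γ a b
  have hf0 : f ≠ 0 := by
    rintro rfl
    have := hf 0
    simp only [Polynomial.eval_zero, zero_smul, add_zero] at this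
    exact hPC this.symm
  let g : F → PGPoint F := fun t => Projectivization.mk F (b + t • a) (hne t)
  have hcover : {P | P.rep ∈ W} ∩ Cgam q γ ⊆
      ((insert (Projectivization.mk F a ha0) (f.roots.toFinset.image g) : Finset (PGPoint F)) :
        Set (PGPoint F)) := by
    rintro R ⟨hRW, hRC⟩
    obtain ⟨r, s, hrs⟩ := hspan _ hRW
    rw [Finset.coe_insert]
    rcases eq_or_ne r 0 with rfl | hr
    · left
      rw [← R.mk_rep, Projectivization.mk_eq_mk_iff']
      exact ⟨s, by rw [hrs, zero_smul, zero_add]⟩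
    · right
      have hR : R = g (r⁻¹ * s) := by
        rw [← R.mk_rep, Projectivization.mk_eq_mk_iff']
        exact ⟨r, by rw [hrs, smul_add, smul_smul, mul_inv_cancel_left₀ hr]⟩
      rw [Finset.mem_coe, Finset.mem_image]
      refine ⟨r⁻¹ * s, ?_, hR.symm⟩
      rw [Multiset.mem_toFinset, Polynomial.mem_roots hf0, Polynomial.IsRoot.def, hf]
      rw [hR] at hRC
      exact (mem_Cgam_mk hq γ _ _).1 hRC
  calc _ ≤ _ := Set.ncard_le_ncard hcover (Finset.finite_toSet _)
    _ = _ := Set.ncard_coe_finset _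
    _ ≤ (f.roots.toFinset.image g).card + 1 := Finset.card_insert_le _ _
    _ ≤ f.roots.toFinset.card + 1 := by gcongr; exact Finset.card_image_le
    _ ≤ f.natDegree + 1 := by
      gcongr
      exact (Multiset.toFinset_card_le _).trans (Polynomial.card_roots' f)
    _ ≤ q + 2 := by omega

/-- The norm equation `N(u) + N(v) = γ c` with `c² = N(u) N(v)` and `γ = x + x⁻¹` has only the
trivial solution when `x ^ (2 * (q + 1)) = 1` and `x ^ 4 ≠ 1`. -/
theorem eq_zero_of_norm_add_norm {F : Type*} [Field F] [Fintype F] {q : ℕ}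
    (hF : Fintype.card F = q ^ 2) {x : F} (hx : x ^ (2 * (q + 1)) = 1) (hx4 : x ^ 4 ≠ 1)
    {u v c : F} (hc : c ^ 2 = u ^ (q + 1) * v ^ (q + 1))
    (h : u ^ (q + 1) + v ^ (q + 1) = (x + x⁻¹) * c) : u = 0 ∧ v = 0 := by
  have hx0 : x ≠ 0 := by
    rintro rfl
    simp at hx
  have hfix : ∀ z : F, (z ^ (q + 1)) ^ q = z ^ (q + 1) := fun z => by
    rw [← pow_mul, add_mul, one_mul, ← sq, pow_add, ← hF, FiniteField.pow_card, pow_succ, mul_comm]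
  have key : ∀ y z : F, z ≠ 0 → y ^ (q + 1) = x ^ 2 * z ^ (q + 1) → False := by
    intro y z hz hyz
    have hpow := congrArg (· ^ q) hyz
    simp only [mul_pow, hfix] at hpow
    have h2 : x ^ 2 = (x ^ 2) ^ q := mul_right_cancel₀ (pow_ne_zero (q + 1) hz)
      (hyz.symm.trans hpow)
    apply hx4
    rw [pow_mul, pow_succ, ← h2] at hx
    rw [← hx]; ring
  have hprod : (u ^ (q + 1) - x ^ 2 * v ^ (q + 1)) * (x ^ 2 * u ^ (q + 1) - v ^ (q + 1)) = 0 := by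
    have h' : x * (u ^ (q + 1) + v ^ (q + 1)) = (x ^ 2 + 1) * c := by
      rw [h]; field_simp
    generalize u ^ (q + 1) = U at *
    generalize v ^ (q + 1) = V at *
    linear_combination (x * (U + V) + (x ^ 2 + 1) * c) * h' + (x ^ 2 + 1) ^ 2 * hc
  have hq1 : q + 1 ≠ 0 := Nat.succ_ne_zero q
  rcases mul_eq_zero.1 hprod with h1 | h1
  · have hv : v = 0 := by
      by_contra hv
      exact key u v hv (sub_eq_zero.1 h1)
    rw [hv, zero_pow hq1, mul_zero, sub_zero] at h1
    exact ⟨(pow_eq_zero_iff hq1).1 h1, hv⟩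
  · have hu : u = 0 := by
      by_contra hu
      exact key v u hu (sub_eq_zero.1 h1).symm
    rw [hu, zero_pow hq1, mul_zero, zero_sub, neg_eq_zero] at h1
    exact ⟨hu, (pow_eq_zero_iff hq1).1 h1⟩

/-- A subspace of dimension two contains a nonzero vector with a prescribed coordinate zero. -/
theorem exists_mem_ne_zero_apply_eq_zero {F : Type*} [Field F] {W : Submodule F (Fin 4 → F)}
    (hW : Module.finrank F W = 2) (i : Fin 4) : ∃ w ∈ W, w ≠ 0 ∧ w i = 0 := by
  have h : LinearMap.ker
      ((LinearMap.proj (R := F) (φ := fun _ : Fin 4 => F) i).domRestrict W) ≠ ⊥ :=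
    LinearMap.ker_ne_bot_of_finrank_lt (by rw [hW, Module.finrank_self]; omega)
  obtain ⟨w, hw, hw0⟩ := Submodule.exists_mem_ne_zero_of_ne_bot h
  exact ⟨w, w.2, fun h => hw0 (Subtype.ext h), hw⟩

theorem not_line_subset_Cgam {F : Type*} [Field F] [Fintype F] {q : ℕ} (hq : Odd q)
    (hF : Fintype.card F = q ^ 2) {x : F} (hx : x ^ (2 * (q + 1)) = 1) (hx4 : x ^ 4 ≠ 1)
    {ℓ : Set (PGPoint F)} (hℓ : IsLine ℓ) : ¬ ℓ ⊆ Cgam q (x + x⁻¹) := by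
  obtain ⟨W, hW, rfl⟩ := hℓ
  intro hsub
  have hzero : ∀ w ∈ W, w ≠ 0 → Fgam q (x + x⁻¹) w = 0 := by
    intro w hw hw0
    rw [← mem_Cgam_mk hq _ w hw0]
    apply hsub
    obtain ⟨c, hc⟩ := Projectivization.exists_smul_eq_mk_rep F w hw0
    change (Projectivization.mk F w hw0).rep ∈ W
    rw [← hc]
    exact W.smul_mem _ hw
  have hq1 : q ≠ 0 := hq.pos.ne'
  have hmid : ∀ w ∈ W, w ≠ 0 → w 0 * w 3 = 0 → w 1 = 0 ∧ w 2 = 0 := by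
    intro w hw hw0 h03
    have h := hzero w hw hw0
    have h1 : w 0 ^ q * w 3 = 0 := by
      rcases mul_eq_zero.1 h03 with h | h <;> simp [h, hq1]
    have h2 : w 0 * w 3 ^ q = 0 := by
      rcases mul_eq_zero.1 h03 with h | h <;> simp [h, hq1]
    rw [Fgam, h1, h2, h03] at h
    refine eq_zero_of_norm_add_norm hF hx hx4 (c := -(0 - w 1 * w 2) ^ ((q + 1) / 2)) ?_
      (by linear_combination -h)
    have he : Even (q + 1) := hq.add_one
    rw [neg_sq, ← pow_mul, Nat.div_mul_cancel he.two_dvd, zero_sub, he.neg_pow, mul_pow]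
  obtain ⟨u, huW, hu0, hu⟩ := exists_mem_ne_zero_apply_eq_zero hW 0
  obtain ⟨v, hvW, hv0, hv⟩ := exists_mem_ne_zero_apply_eq_zero hW 3
  obtain ⟨hu1, hu2⟩ := hmid u huW hu0 (by simp [hu])
  obtain ⟨hv1, hv2⟩ := hmid v hvW hv0 (by simp [hv])
  have hu3 : u 3 ≠ 0 := fun h => hu0 (by ext i; fin_cases i <;> assumption)
  have hv3 : v 0 ≠ 0 := fun h => hv0 (by ext i; fin_cases i <;> assumption)
  have hmem : (v 0)⁻¹ • v + (u 3)⁻¹ • u ∈ W := W.add_mem (W.smul_mem _ hvW) (W.smul_mem _ huW)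
  have h0 : ((v 0)⁻¹ • v + (u 3)⁻¹ • u) 0 = 1 := by simp [hu, hv3]
  have h := hzero _ hmem (fun h => by rw [h] at h0; exact zero_ne_one h0)
  have h2 : 2 = x + x⁻¹ := by
    simp [Fgam, hu, hu1, hu2, hv, hv1, hv2, hu3, hv3] at h
    linear_combination h
  have hx0 : x ≠ 0 := by
    rintro rfl
    simp at hx
  field_simp at h2
  have h1 : x = 1 := sub_eq_zero.1 (pow_eq_zero_iff two_ne_zero |>.1
    (show (x - 1) ^ 2 = 0 by linear_combination -h2))
  exact hx4 (by rw [h1, one_pow])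

theorem orderOf_eq_card_sub_one {F : Type*} [Field F] [Fintype F] (hcard : 2 < Fintype.card F)
    {ξ : F} (hξ : ∀ x : F, x ≠ 0 → ∃ m : ℕ, x = ξ ^ m) : orderOf ξ = Fintype.card F - 1 := by
  classical
  have hξ0 : ξ ≠ 0 := by
    rintro rfl
    have hsub : (Finset.univ : Finset F) ⊆ {0, 1} := by
      intro y _
      rw [Finset.mem_insert, Finset.mem_singleton]
      refine or_iff_not_imp_left.2 fun hy => ?_
      obtain ⟨m, rfl⟩ := hξ y hy
      rcases eq_or_ne m 0 with rfl | hm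
      · exact pow_zero _
      · exact absurd (zero_pow hm) hy
    have := (Finset.card_le_card hsub).trans Finset.card_le_two
    rw [Finset.card_univ] at this
    omega
  rw [← Fintype.card_units, ← Nat.card_eq_fintype_card, ← Units.val_mk0 hξ0, orderOf_units]
  refine orderOf_eq_card_of_forall_mem_powers fun y => ?_
  obtain ⟨m, hm⟩ := hξ y y.ne_zero
  exact ⟨m, Units.ext (by simp [hm])⟩

/-- Lemma 2.14: `|ℓ ∩ S_j| ≤ 2q+2` for every line `ℓ`, and `|ℓ ∩ E_k| ≤ 2q+2` for
    every line `ℓ` not contained in `E_k`. -/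
theorem stmt12 {F : Type*} [Field F] [Fintype F] (p n q : ℕ) (hp : p.Prime)
    (hodd : Odd p) (hn : 0 < n) (hq : q = p ^ n) (hF : Fintype.card F = q ^ 2)
    (ξ : F) (hξ : ∀ x : F, x ≠ 0 → ∃ m : ℕ, x = ξ ^ m) :
    (∀ j : ℕ, 1 ≤ j → j ≤ q → j ≠ (q + 1) / 2 →
      ∀ ℓ : Set (PGPoint F), IsLine ℓ →
        (ℓ ∩ Cgam q (ξ ^ (j * (q - 1) / 2) + (ξ ^ (j * (q - 1) / 2))⁻¹)).ncard
          ≤ 2 * q + 2) ∧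
    (∀ k : ℕ, 1 ≤ k → k ≤ q - 2 → k ≠ (q - 1) / 2 →
      ∀ ℓ : Set (PGPoint F), IsLine ℓ →
        ¬ ℓ ⊆ Cgam q (ξ ^ (k * (q + 1) / 2) + (ξ ^ (k * (q + 1) / 2))⁻¹) →
        (ℓ ∩ Cgam q (ξ ^ (k * (q + 1) / 2) + (ξ ^ (k * (q + 1) / 2))⁻¹)).ncard
          ≤ 2 * q + 2) := by
  have hqo : Odd q := hq ▸ hodd.pow
  have hq3 : 3 ≤ q := by
    have h1 : q ≠ 1 := hq ▸ (Nat.one_lt_pow hn.ne' hp.one_lt).ne'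
    obtain ⟨m, rfl⟩ := hqo
    omega
  have hcard : 2 < Fintype.card F := by rw [hF]; nlinarith
  refine ⟨fun j hj1 hjq hjm ℓ hℓ => ?_, fun k _ _ _ ℓ hℓ hsub =>
    (ncard_line_inter_Cgam_le hqo _ hℓ hsub).trans (by omega)⟩
  refine (ncard_line_inter_Cgam_le hqo _ hℓ (not_line_subset_Cgam hqo hF ?_ ?_ hℓ)).trans
    (by omega)
  all_goals
    have hord : orderOf ξ = (q + 1) * (q - 1) := by
      rw [orderOf_eq_card_sub_one hcard hξ, hF, ← Nat.sq_sub_sq, one_pow]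
    have hdvd : j * (q - 1) / 2 * 2 = j * (q - 1) :=
      Nat.div_mul_cancel ((hqo.tsub_odd odd_one).two_dvd.mul_left j)
  · rw [← pow_mul, ← mul_assoc, hdvd, ← orderOf_dvd_iff_pow_eq_one, hord]
    exact ⟨j, by ring⟩
  · rw [← pow_mul, Ne, ← orderOf_dvd_iff_pow_eq_one, hord,
      show j * (q - 1) / 2 * 4 = 2 * j * (q - 1) by linear_combination 2 * hdvd]
    intro h
    obtain ⟨c, hc⟩ := Nat.dvd_of_mul_dvd_mul_right (by omega) h
    have hc1 : c < 2 := by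
      by_contra! hc2
      nlinarith
    interval_cases c <;> omega
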